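/- Let N ∈ ℕ grow to infinity and γ = γ_N > 1/2 satisfy γ_N → 1/2 and (γ_N − 1/2)·√N → ∞. Then for X ~ Binomial(N, 1/2), as N → ∞: P(X = ⌈γN⌉) = exp(−N·r(γ,1/2) − (log N)/2 + O(1)) and P(X ≥ ⌈γN⌉) = exp(−N·r(γ,1/2) − Ω(log((γ − 1/2)·√N))). -/

import Mathlib

open Filter Finset

noncomputable section

/-- The natural-log binary entropy function. -/
noncomputable def binEnt (x : ℝ) : ℝ := -(x * Real.log x) - (1 - x) * Real.log (1 - x)

/-- `r(γ,1/2) = log 2 − h(γ)`. -/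
noncomputable def rRate (γ : ℝ) : ℝ := Real.log 2 - binEnt γ

theorem log_factorial_upper_bound {n : ℕ} (hn : n ≠ 0) :
    Real.log (n.factorial : ℝ) ≤ n * Real.log n - n + Real.log n / 2 + 1 := by
  obtain ⟨m, rfl⟩ := Nat.exists_eq_succ_of_ne_zero hn
  have hanti := Stirling.log_stirlingSeq'_antitone (Nat.zero_le m)
  simp only [Function.comp_apply] at hanti
  rw [Stirling.log_stirlingSeq_formula, Nat.succ_eq_add_one, Nat.succ_eq_add_one, zero_add,
    Stirling.stirlingSeq_one, Real.log_div (Real.exp_ne_zero 1) (by positivity), Real.log_exp,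
    Real.log_sqrt (by norm_num), Real.log_mul (by norm_num) (by positivity),
    Real.log_div (by positivity) (Real.exp_ne_zero 1), Real.log_exp] at hanti
  rw [Nat.succ_eq_add_one]
  linarith

theorem log_factorial_lower_bound {n : ℕ} (hn : n ≠ 0) :
    n * Real.log n - n + Real.log n / 2 ≤ Real.log (n.factorial : ℝ) := by
  have hpi : 0 ≤ Real.log (2 * Real.pi) :=
    Real.log_nonneg (by linarith [Real.pi_gt_three])
  linarith [Stirling.le_log_factorial_stirling hn]

/-- Gibbs' inequality for two Bernoulli distributions. -/
theorem binEnt_le_cross_entropy {a b : ℝ} (ha : 0 < a) (ha1 : a < 1) (hb : 0 < b) (hb1 : b < 1) :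
    binEnt a ≤ -(a * Real.log b) - (1 - a) * Real.log (1 - b) := by
  have key : ∀ {x y : ℝ}, 0 < x → 0 < y → x * (Real.log y - Real.log x) ≤ y - x := by
    intro x y hx hy
    rw [← Real.log_div hy.ne' hx.ne']
    calc x * Real.log (y / x) ≤ x * (y / x - 1) := by
          gcongr
          exact Real.log_le_sub_one_of_pos (by positivity)
      _ = y - x := by field_simp
  have h₁ := key ha hb
  have h₂ := key (sub_pos.2 ha1) (sub_pos.2 hb1)
  unfold binEnt
  linarith

theorem binEnt_le_of_half_lt_of_le {a b : ℝ} (ha : 1 / 2 < a) (hab : a ≤ b) (hb : b < 1) :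
    binEnt b ≤ binEnt a := by
  have hgibbs := binEnt_le_cross_entropy (a := b) (b := a) (by linarith) hb (by linarith)
    (by linarith)
  have hlog : Real.log (1 - a) ≤ Real.log a := Real.log_le_log (by linarith) (by linarith)
  have hprod := mul_nonneg (sub_nonneg.2 hab) (sub_nonneg.2 hlog)
  have hdef : binEnt a = -(a * Real.log a) - (1 - a) * Real.log (1 - a) := rfl
  linarith

theorem binEnt_sub_le_of_le_three_quarters {a b : ℝ} (ha : 0 < a) (hab : a ≤ b)
    (hb : b ≤ 3 / 4) : binEnt a - binEnt b ≤ (b - a) * 2 := by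
  have hgibbs := binEnt_le_cross_entropy (a := a) (b := b) ha (by linarith) (by linarith)
    (by linarith)
  have hlog : Real.log b - Real.log (1 - b) ≤ 2 := by
    rw [← Real.log_div (by linarith) (by linarith)]
    have hratio : b / (1 - b) ≤ 3 := by
      rw [div_le_iff₀ (by linarith)]
      linarith
    have := Real.log_le_sub_one_of_pos (x := b / (1 - b)) (div_pos (by linarith) (by linarith))
    linarith
  have hprod := mul_le_mul_of_nonneg_left hlog (sub_nonneg.2 hab)
  have hdef : binEnt b = -(b * Real.log b) - (1 - b) * Real.log (1 - b) := rfl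
  linarith

/-- The entropy estimate for binomial coefficients with ratio bounded away from the endpoints. -/
theorem abs_log_choose_sub_le {N k : ℕ} (hk : (N : ℝ) / 2 ≤ k) (hk' : (k : ℝ) ≤ 3 / 4 * N)
    (hN : 0 < N) :
    |Real.log (N.choose k : ℝ) - (N * binEnt (k / N) - Real.log N / 2)| ≤ 5 := by
  have hNr : (0 : ℝ) < N := by exact_mod_cast hN
  have hkr : (0 : ℝ) < k := by linarith
  have hkN : k ≤ N := by
    have : (k : ℝ) ≤ N := by linarith
    exact_mod_cast this
  obtain ⟨l, rfl⟩ := Nat.exists_eq_add_of_le hkN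
  push_cast at *
  have hlr : (0 : ℝ) < l := by linarith
  have hk0 : k ≠ 0 := by rintro rfl; simp at hkr
  have hl0 : l ≠ 0 := by rintro rfl; simp at hlr
  have hchoose : Real.log ((k + l).choose k : ℝ) = Real.log ((k + l).factorial : ℝ) -
      Real.log (k.factorial : ℝ) - Real.log (l.factorial : ℝ) := by
    rw [Nat.cast_add_choose, Real.log_div (by positivity) (by positivity),
      Real.log_mul (by positivity) (by positivity)]
    ring
  have hent : ((k : ℝ) + l) * binEnt (k / (k + l)) =
      (k + l) * Real.log (k + l) - k * Real.log k - l * Real.log l := by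
    have hcompl : (1 : ℝ) - k / (k + l) = l / (k + l) := by field_simp; ring
    unfold binEnt
    rw [hcompl, Real.log_div (by positivity) (by positivity),
      Real.log_div (by positivity) (by positivity)]
    field_simp
    ring
  have hlog2 : Real.log 2 ≤ 1 := by linarith [Real.log_two_lt_d9]
  have hlog4 : Real.log 4 = 2 * Real.log 2 := by
    rw [show (4 : ℝ) = 2 ^ 2 by norm_num, Real.log_pow]
    norm_num
  have h₁ : Real.log k ≤ Real.log (k + l) := Real.log_le_log hkr (by linarith)
  have h₂ : Real.log l ≤ Real.log (k + l) := Real.log_le_log hlr (by linarith)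
  have h₃ : Real.log (k + l) ≤ Real.log 2 + Real.log k := by
    rw [← Real.log_mul (by norm_num) hkr.ne']
    exact Real.log_le_log hNr (by linarith)
  have h₄ : Real.log (k + l) ≤ Real.log 4 + Real.log l := by
    rw [← Real.log_mul (by norm_num) hlr.ne']
    exact Real.log_le_log hNr (by linarith)
  have u₁ := log_factorial_upper_bound hk0
  have u₂ := log_factorial_upper_bound hl0
  have u₃ := log_factorial_upper_bound hN.ne'
  have l₁ := log_factorial_lower_bound hk0
  have l₂ := log_factorial_lower_bound hl0
  have l₃ := log_factorial_lower_bound hN.ne'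
  push_cast at u₃ l₃
  rw [hchoose, hent, abs_le]
  constructor <;> linarith

theorem abs_log_point_mass_sub_le {N : ℕ} {g : ℝ} (hg : 1 / 2 < g) (hg' : g ≤ 5 / 8)
    (hN : 8 ≤ N) :
    |Real.log ((N.choose ⌈g * (N : ℝ)⌉₊ : ℝ) / 2 ^ N) -
      (-(N : ℝ) * rRate g - Real.log N / 2)| ≤ 7 := by
  have hN8 : (8 : ℝ) ≤ N := by exact_mod_cast hN
  have hNr : (0 : ℝ) < N := by linarith
  have hk := Nat.le_ceil (g * (N : ℝ))
  have hk' := (Nat.ceil_lt_add_one (a := g * (N : ℝ)) (by positivity)).le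
  set k := ⌈g * (N : ℝ)⌉₊
  have hgN := mul_le_mul_of_nonneg_right hg' hNr.le
  have hgN' := mul_le_mul_of_nonneg_right hg.le hNr.le
  have hkN : (k : ℝ) ≤ 3 / 4 * N := by linarith
  have hmain := abs_le.1 (abs_log_choose_sub_le (by linarith) hkN (by lia))
  have hle : g ≤ k / N := by rwa [le_div_iff₀ hNr]
  have hp : (k : ℝ) / N ≤ 3 / 4 := by rwa [div_le_iff₀ hNr]
  have hup := mul_le_mul_of_nonneg_left
    (binEnt_le_of_half_lt_of_le hg hle (by linarith)) hNr.le
  have hlow := mul_le_mul_of_nonneg_left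
    (binEnt_sub_le_of_le_three_quarters (by linarith) hle hp) hNr.le
  have hdiff : (N : ℝ) * ((k / N - g) * 2) = (k - g * N) * 2 := by field_simp
  rw [hdiff] at hlow
  have hchoose : (0 : ℝ) < N.choose k := by
    have : (k : ℝ) ≤ N := by linarith
    exact_mod_cast Nat.choose_pos (by exact_mod_cast this)
  rw [Real.log_div hchoose.ne' (by positivity), Real.log_pow]
  unfold rRate
  rw [abs_le]
  constructor <;> linarith

theorem sum_choose_upper_tail_mul_le {N k : ℕ} (hk : k ≤ N) :
    (∑ j ∈ Icc k N, (N.choose j : ℝ)) * (2 * k - N) ≤ k * N.choose k := by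
  induction hk using Nat.decreasingInduction with
  | self =>
    simp
    linarith
  | of_succ k hk ih =>
    have hrec : ((N.choose (k + 1) : ℝ)) * (k + 1) = N.choose k * (N - k) := by
      have := congrArg (Nat.cast (R := ℝ)) (Nat.choose_succ_right_eq N k)
      rw [Nat.cast_mul, Nat.cast_mul, Nat.cast_sub hk.le] at this
      exact_mod_cast this
    have hnonneg : (0 : ℝ) ≤ ∑ j ∈ Icc (k + 1) N, (N.choose j : ℝ) := by positivity
    rw [← insert_Icc_add_one_left_eq_Icc hk.le, sum_insert (by simp)]
    push_cast at ih
    linarith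

/-- Comparison of an upper tail with its first term. -/
theorem binomial_upper_tail_le {N k : ℕ} {g : ℝ} (hg : 1 / 2 < g) (hN : 0 < N)
    (hgk : g * N ≤ k) (hk : k ≤ N) :
    ∑ j ∈ Icc k N, (N.choose j : ℝ) / 2 ^ N ≤ (N.choose k : ℝ) / 2 ^ N / (2 * (g - 1 / 2)) := by
  have hNr : (0 : ℝ) < N := by exact_mod_cast hN
  have hkr : (k : ℝ) ≤ N := by exact_mod_cast hk
  have htail := sum_choose_upper_tail_mul_le hk
  have hnonneg : (0 : ℝ) ≤ ∑ j ∈ Icc k N, (N.choose j : ℝ) := by positivity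
  rw [← sum_div, div_right_comm]
  gcongr
  rw [le_div_iff₀ (by linarith)]
  refine le_of_mul_le_mul_right ?_ hNr
  calc _ = (∑ j ∈ Icc k N, (N.choose j : ℝ)) * (2 * (g * N) - N) := by ring
    _ ≤ (∑ j ∈ Icc k N, (N.choose j : ℝ)) * (2 * k - N) := by gcongr
    _ ≤ k * N.choose k := htail
    _ ≤ N * N.choose k := by gcongr
    _ = _ := mul_comm _ _

/-- Sharp asymptotics for the point mass and upper tail of
`Binomial(N,1/2)` at `⌈γN⌉` when `γ_N → 1/2` with `(γ_N − 1/2)√N → ∞`: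
`P(X = ⌈γN⌉) = exp(−N r(γ,1/2) − (log N)/2 + O(1))` and
`P(X ≥ ⌈γN⌉) = exp(−N r(γ,1/2) − Ω(log((γ−1/2)√N)))`. -/
theorem binomial_point_and_tail (γ : ℕ → ℝ)
    (hγ : ∀ N, 1/2 < γ N)
    (hγ0 : Tendsto γ atTop (nhds (1/2)))
    (hγN : Tendsto (fun N : ℕ => (γ N - 1/2) * Real.sqrt N) atTop atTop) :
    (∃ M : ℝ, ∀ᶠ N : ℕ in atTop,
      |Real.log ((N.choose ⌈γ N * (N : ℝ)⌉₊ : ℝ) / 2 ^ N) -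
          (-(N : ℝ) * rRate (γ N) - Real.log N / 2)| ≤ M) ∧
    (∃ c : ℝ, 0 < c ∧ ∀ᶠ N : ℕ in atTop,
      Real.log (∑ j ∈ Finset.Icc ⌈γ N * (N : ℝ)⌉₊ N, (N.choose j : ℝ) / 2 ^ N) ≤
        -(N : ℝ) * rRate (γ N) - c * Real.log ((γ N - 1/2) * Real.sqrt N)) := by
  have hpoint : ∀ᶠ N : ℕ in atTop, γ N ≤ 5 / 8 ∧ 8 ≤ N :=
    (hγ0.eventually_le_const (by norm_num)).and (eventually_ge_atTop 8)
  refine ⟨⟨7, ?_⟩, 1 / 2, by norm_num, ?_⟩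
  · filter_upwards [hpoint] with N hN
    exact abs_log_point_mass_sub_le (hγ N) hN.1 hN.2
  · have hlogtop := (Real.tendsto_log_atTop.comp hγN).eventually_ge_atTop 14
    filter_upwards [hpoint, hlogtop] with N hN hlarge
    obtain ⟨hγ', hN8⟩ := hN
    have hpm := (abs_le.1 (abs_log_point_mass_sub_le (hγ N) hγ' hN8)).2
    have hN8r : (8 : ℝ) ≤ N := by exact_mod_cast hN8
    have hNr : (0 : ℝ) < N := by linarith
    have hγpos := hγ N
    have hdiff : 0 < γ N - 1 / 2 := by linarith
    have hgk := Nat.le_ceil (γ N * (N : ℝ))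
    have hkN : ⌈γ N * (N : ℝ)⌉₊ ≤ N := Nat.ceil_le.2 (by nlinarith)
    have htail := binomial_upper_tail_le hγpos (by lia : 0 < N) hgk hkN
    set k := ⌈γ N * (N : ℝ)⌉₊
    have hchoose : (0 : ℝ) < N.choose k := by exact_mod_cast Nat.choose_pos hkN
    have hpos : 0 < ∑ j ∈ Icc k N, (N.choose j : ℝ) / 2 ^ N :=
      lt_of_lt_of_le (by positivity)
        (single_le_sum (f := fun j => (N.choose j : ℝ) / 2 ^ N) (fun _ _ => by positivity)
          (left_mem_Icc.2 hkN))
    have hlog := Real.log_le_log hpos htail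
    rw [Real.log_div (by positivity) (by positivity),
      Real.log_mul (by norm_num) hdiff.ne'] at hlog
    simp only [Function.comp_apply] at hlarge
    rw [Real.log_mul hdiff.ne' (by positivity), Real.log_sqrt hNr.le] at hlarge ⊢
    have hlog2 : 0 ≤ Real.log 2 := Real.log_nonneg (by norm_num)
    linarith

end
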